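/- For all nonnegative integers m and n and every x > 0, one has (−1)^{m+n+1}(Φ^{(m+n+1)}(x) + ω Φ^{(m)}(x) Φ^{(n)}(x)) = ∫_0^∞ [1 − ω/𝔜_{m,n}(t)]·t^{m+n+1} h(t) e^{−xt} dt for every real ω, where 𝔜_{m,n}(t) = t^{m+n+1} h(t) / ∫_0^t u^m (t−u)^n h(u) h(t−u) du. -/

import Mathlib

open MeasureTheory

noncomputable def h (t : ℝ) : ℝ :=
  if t = 0 then 1 / 2 else Real.exp t * (Real.exp t - 1 - t) / (Real.exp t - 1) ^ 2

/-- `Φ x = x * ψ'(x) - 1`, where `ψ'` is the trigamma function, i.e. the second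
derivative of the logarithm of the gamma function. -/
noncomputable def Phi (x : ℝ) : ℝ :=
  x * iteratedDeriv 2 (fun y => Real.log (Real.Gamma y)) x - 1

noncomputable def frakY (m n : ℕ) (t : ℝ) : ℝ :=
  t ^ (m + n + 1) * h t / ∫ u in (0:ℝ)..t, u ^ m * (t - u) ^ n * h u * h (t - u)

open Filter Topology Set

/-- Increments of the Bohr-Mollerup sequence for `log Γ`. -/
noncomputable def logGammaTerm (n : ℕ) (x : ℝ) : ℝ :=
  x * (Real.log (n + 1) - Real.log n) + Real.log (n + 1) - Real.log (x + n + 1)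

/-- The derivative of `logGammaTerm n`. -/
noncomputable def logGammaTermDeriv (n : ℕ) (x : ℝ) : ℝ :=
  Real.log (n + 1) - Real.log n - (x + n + 1)⁻¹

lemma sum_logGammaTerm (x : ℝ) (N : ℕ) :
    ∑ n ∈ Finset.range N, logGammaTerm n x =
      Real.BohrMollerup.logGammaSeq x N + Real.log x := by
  induction N with
  | zero => simp [Real.BohrMollerup.logGammaSeq]
  | succ N ih =>
    rw [Finset.sum_range_succ, ih]
    have hN : ((N.factorial : ℕ) : ℝ) ≠ 0 := by positivity
    have hN' : ((N : ℝ) + 1) ≠ 0 := by positivity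
    simp only [Real.BohrMollerup.logGammaSeq, logGammaTerm, Finset.sum_range_succ,
      Nat.factorial_succ]
    push_cast
    rw [Real.log_mul hN' hN]
    ring_nf

lemma hasDerivAt_logGammaTerm (n : ℕ) {x : ℝ} (hx : -1 < x) :
    HasDerivAt (logGammaTerm n) (logGammaTermDeriv n x) x := by
  have hn : (0 : ℝ) ≤ n := n.cast_nonneg
  have h1 : x + n + 1 ≠ 0 := by linarith
  have h2 : HasDerivAt (fun y : ℝ => y + n + 1) 1 x := ((hasDerivAt_id x).add_const _).add_const _
  have h3 := (((hasDerivAt_id x).mul_const (Real.log (n + 1) - Real.log n)).add_const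
    (Real.log (n + 1))).sub (h2.log h1)
  convert! h3 using 1
  simp [logGammaTermDeriv]

lemma hasDerivAt_logGammaTermDeriv (n : ℕ) {x : ℝ} (hx : -1 < x) :
    HasDerivAt (logGammaTermDeriv n) (((x + n + 1) ^ 2)⁻¹) x := by
  have hn : (0 : ℝ) ≤ n := n.cast_nonneg
  have h1 : x + n + 1 ≠ 0 := by linarith
  have h2 : HasDerivAt (fun y : ℝ => y + n + 1) 1 x := ((hasDerivAt_id x).add_const _).add_const _
  have h3 := (h2.inv h1).const_sub (Real.log (n + 1) - Real.log n)
  convert! h3 using 1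
  simp [neg_div]

lemma abs_logGammaTermDeriv_le (n : ℕ) {x R : ℝ} (hx : -(1 / 2) < x) (hxR : x < R) (hR : 0 < R) :
    ‖logGammaTermDeriv n x‖ ≤ 4 * (1 + R) * (((n : ℝ) + 1) ^ 2)⁻¹ := by
  rcases Nat.eq_zero_or_pos n with rfl | hn
  · have h1 : (1 / 2 : ℝ) < x + 1 := by linarith
    have h2 : (x + 1)⁻¹ ≤ 2 := by
      rw [inv_le_comm₀ (by linarith) two_pos]; linarith
    have h3 : 0 < (x + 1)⁻¹ := by positivity
    simp only [logGammaTermDeriv, Nat.cast_zero, zero_add, Real.log_one, Real.log_zero, sub_zero,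
      add_zero, zero_sub, norm_neg, Real.norm_eq_abs, abs_of_pos h3]
    norm_num
    linarith
  · have hn' : (1 : ℝ) ≤ n := by exact_mod_cast hn
    have hn0 : (0 : ℝ) < n := by linarith
    have hlog : Real.log (n + 1) - Real.log n = Real.log ((n + 1) / n) := by
      rw [Real.log_div (by positivity) (by positivity)]
    have hup : Real.log (((n : ℝ) + 1) / n) ≤ 1 / n := by
      refine (Real.log_le_sub_one_of_pos (by positivity)).trans (le_of_eq ?_)
      field_simp; ring
    have hlo : 1 / ((n : ℝ) + 1) ≤ Real.log (((n : ℝ) + 1) / n) := by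
      refine le_trans (le_of_eq ?_) (Real.one_sub_inv_le_log_of_pos (by positivity))
      field_simp; ring
    have h0 : 0 < x + n + 1 := by linarith
    rw [logGammaTermDeriv, hlog, Real.norm_eq_abs, abs_le]
    constructor
    · have : (x + n + 1)⁻¹ - 1 / ((n : ℝ) + 1) ≤ 4 * (1 + R) * (((n : ℝ) + 1) ^ 2)⁻¹ := by
        have h5 : (x + n + 1)⁻¹ ≤ ((n : ℝ) + 1 / 2)⁻¹ := by
          gcongr ?_⁻¹
          linarith
        have h6 : ((n : ℝ) + 1 / 2)⁻¹ - 1 / ((n : ℝ) + 1) ≤ 4 * (((n : ℝ) + 1) ^ 2)⁻¹ := by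
          rw [← sub_nonneg]
          have : 4 * (((n : ℝ) + 1) ^ 2)⁻¹ - (((n : ℝ) + 1 / 2)⁻¹ - 1 / ((n : ℝ) + 1))
            = (4 * (n + 1 / 2) - (n + 1) / 2) / ((n + 1) ^ 2 * (n + 1 / 2)) := by
            field_simp; ring
          rw [this]
          apply div_nonneg _ (by positivity)
          linarith
        have h7 : 0 ≤ R * (((n : ℝ) + 1) ^ 2)⁻¹ := by positivity
        linarith
      linarith
    · have h5 : ((R + n + 1))⁻¹ ≤ (x + n + 1)⁻¹ := by
        gcongr
      have h6 : 1 / (n : ℝ) - (R + n + 1)⁻¹ ≤ 4 * (1 + R) * (((n : ℝ) + 1) ^ 2)⁻¹ := by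
        have e : 1 / (n : ℝ) - (R + n + 1)⁻¹ = (1 + R) * (n * (R + n + 1))⁻¹ := by
          field_simp; ring
        rw [e, mul_comm 4, mul_assoc]
        gcongr
        rw [← div_eq_mul_inv, inv_eq_one_div, div_le_div_iff₀ (by positivity) (by positivity)]
        nlinarith
      linarith

lemma summable_inv_succ_sq : Summable fun n : ℕ => (((n : ℝ) + 1) ^ 2)⁻¹ := by
  have := (summable_nat_add_iff 1).2 (Real.summable_nat_pow_inv.2 one_lt_two)
  simpa using this

lemma summable_inv_add_sq {x : ℝ} (hx : 0 < x) :
    Summable fun n : ℕ => ((x + n) ^ 2)⁻¹ := by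
  refine (summable_nat_add_iff 1).1 (Summable.of_nonneg_of_le (fun n => by positivity)
    (fun n => ?_) summable_inv_succ_sq)
  push_cast
  exact inv_anti₀ (by positivity) (pow_le_pow_left₀ (by positivity) (by linarith) 2)

lemma hasDerivAt_tsum_logGammaTerm {x : ℝ} (hx : 0 < x) :
    Summable (fun n => logGammaTerm n x) ∧
    HasDerivAt (fun y => ∑' n, logGammaTerm n y) (∑' n, logGammaTermDeriv n x) x := by
  have hu : Summable fun n : ℕ => 4 * (1 + (x + 1)) * (((n : ℝ) + 1) ^ 2)⁻¹ :=
    summable_inv_succ_sq.mul_left _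
  have hd : ∀ (n : ℕ) (y : ℝ), y ∈ Ioo (-(1 / 2)) (x + 1) →
      HasDerivAt (logGammaTerm n) (logGammaTermDeriv n y) y := fun n y hy =>
    hasDerivAt_logGammaTerm n (by linarith [hy.1])
  have hb : ∀ (n : ℕ) (y : ℝ), y ∈ Ioo (-(1 / 2)) (x + 1) →
      ‖logGammaTermDeriv n y‖ ≤ 4 * (1 + (x + 1)) * (((n : ℝ) + 1) ^ 2)⁻¹ := fun n y hy =>
    abs_logGammaTermDeriv_le n hy.1 hy.2 (by linarith)
  have h0 : (0 : ℝ) ∈ Ioo (-(1 / 2)) (x + 1) := ⟨by norm_num, by linarith⟩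
  have hx' : x ∈ Ioo (-(1 / 2)) (x + 1) := ⟨by linarith, by linarith⟩
  have hs : Summable fun n => logGammaTerm n 0 := by simp [logGammaTerm]
  exact ⟨summable_of_summable_hasDerivAt_of_isPreconnected hu isOpen_Ioo isPreconnected_Ioo
      hd hb h0 hs hx',
    hasDerivAt_tsum_of_isPreconnected hu isOpen_Ioo isPreconnected_Ioo hd hb h0 hs hx'⟩

lemma log_Gamma_eq_tsum {x : ℝ} (hx : 0 < x) :
    Real.log (Real.Gamma x) = ∑' n, logGammaTerm n x - Real.log x := by
  have h1 := (hasDerivAt_tsum_logGammaTerm hx).1.hasSum.tendsto_sum_nat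
  simp_rw [sum_logGammaTerm] at h1
  have h2 := (Real.BohrMollerup.tendsto_log_gamma hx).add_const (Real.log x)
  linarith [tendsto_nhds_unique h1 h2]

lemma hasDerivAt_tsum_logGammaTermDeriv {x : ℝ} (hx : 0 < x) :
    HasDerivAt (fun y => ∑' n, logGammaTermDeriv n y) (∑' n : ℕ, ((x + n + 1) ^ 2)⁻¹) x := by
  refine hasDerivAt_tsum_of_isPreconnected (t := Ioi 0) (y₀ := x) summable_inv_succ_sq isOpen_Ioi
    isPreconnected_Ioi (fun n y hy => hasDerivAt_logGammaTermDeriv n (by linarith [mem_Ioi.1 hy]))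
    (fun n y hy => ?_) hx ?_ hx
  · have : (0 : ℝ) < y := hy
    rw [norm_inv, norm_pow, Real.norm_of_nonneg (by positivity)]
    gcongr
    linarith
  · refine Summable.of_norm_bounded (summable_inv_succ_sq.mul_left (4 * (1 + (x + 1)))) fun n => ?_
    exact abs_logGammaTermDeriv_le n (by linarith) (by linarith) (by linarith)

/-- The trigamma function as a series. -/
theorem iteratedDeriv_two_log_Gamma {x : ℝ} (hx : 0 < x) :
    iteratedDeriv 2 (fun y => Real.log (Real.Gamma y)) x = ∑' n : ℕ, ((x + n) ^ 2)⁻¹ := by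
  have h1 : ∀ y : ℝ, 0 < y → deriv (fun y => Real.log (Real.Gamma y)) y =
      ∑' n, logGammaTermDeriv n y - y⁻¹ := fun y hy => by
    have : HasDerivAt (fun y => Real.log (Real.Gamma y))
        (∑' n, logGammaTermDeriv n y - y⁻¹) y := by
      refine ((hasDerivAt_tsum_logGammaTerm hy).2.sub
        (Real.hasDerivAt_log hy.ne')).congr_of_eventuallyEq ?_
      filter_upwards [Ioi_mem_nhds hy] with z hz using log_Gamma_eq_tsum hz
    exact this.deriv
  have h2 : HasDerivAt (deriv fun y => Real.log (Real.Gamma y))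
      (∑' n : ℕ, ((x + n + 1) ^ 2)⁻¹ - -(x ^ 2)⁻¹) x := by
    refine ((hasDerivAt_tsum_logGammaTermDeriv hx).sub
      (hasDerivAt_inv hx.ne')).congr_of_eventuallyEq ?_
    filter_upwards [Ioi_mem_nhds hx] with z hz using h1 z hz
  rw [iteratedDeriv_succ, iteratedDeriv_one, h2.deriv]
  rw [(summable_inv_add_sq hx).tsum_eq_zero_add]
  push_cast
  simp only [add_zero, add_assoc]
  ring

lemma integrableOn_pow_mul_exp (k : ℕ) {x : ℝ} (hx : 0 < x) :
    IntegrableOn (fun t : ℝ => t ^ k * Real.exp (-x * t)) (Ioi 0) := by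
  have := integrableOn_rpow_mul_exp_neg_mul_rpow (p := 1) (s := k)
    (by linarith [(Nat.cast_nonneg k : (0 : ℝ) ≤ k)]) one_pos hx
  simpa using this

lemma integral_mul_exp {x : ℝ} (hx : 0 < x) :
    ∫ t in Ioi (0 : ℝ), t * Real.exp (-x * t) = (x ^ 2)⁻¹ := by
  have := Real.integral_rpow_mul_exp_neg_mul_Ioi (a := 2) two_pos hx
  norm_num [Real.Gamma_two] at this
  simpa using this

/-- The density `t / (1 - exp (-t))` of the Laplace representation of the trigamma function. -/
noncomputable def trigammaKernel (t : ℝ) : ℝ := t / (1 - Real.exp (-t))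

lemma one_sub_exp_neg_pos {t : ℝ} (ht : 0 < t) : 0 < 1 - Real.exp (-t) := by
  have : Real.exp (-t) < 1 := by simpa using ht
  linarith

lemma trigammaKernel_le {t : ℝ} (ht : 0 < t) : trigammaKernel t ≤ 1 + t := by
  rw [trigammaKernel, div_le_iff₀ (one_sub_exp_neg_pos ht)]
  have h1 := Real.add_one_le_exp t
  have h2 : Real.exp (-t) * Real.exp t = 1 := by rw [← Real.exp_add]; simp
  nlinarith [Real.exp_pos (-t), mul_le_mul_of_nonneg_left h1 (Real.exp_pos (-t)).le]

lemma one_le_trigammaKernel {t : ℝ} (ht : 0 < t) : 1 ≤ trigammaKernel t := by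
  rw [trigammaKernel, le_div_iff₀ (one_sub_exp_neg_pos ht)]
  linarith [Real.add_one_le_exp (-t)]

lemma h_pos {t : ℝ} (ht : 0 < t) : 0 < h t := by
  have h1 := Real.add_one_lt_exp ht.ne'
  have h2 : 0 < Real.exp t - 1 := by linarith
  rw [h, if_neg ht.ne']
  have : 0 < Real.exp t - 1 - t := by linarith
  positivity

lemma h_le_one {t : ℝ} (ht : 0 < t) : h t ≤ 1 := by
  have h1 := Real.add_one_lt_exp ht.ne'
  have h2 : 0 < Real.exp t - 1 := by linarith
  rw [h, if_neg ht.ne', div_le_one (by positivity)]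
  have h3 := Real.add_one_le_exp (-t)
  have h4 : Real.exp (-t) * Real.exp t = 1 := by rw [← Real.exp_add]; simp
  nlinarith [mul_le_mul_of_nonneg_right h3 (Real.exp_pos t).le]

lemma measurable_h : Measurable h := by
  refine Measurable.ite (measurableSet_singleton 0) measurable_const ?_
  fun_prop

lemma hasDerivAt_trigammaKernel {t : ℝ} (ht : 0 < t) :
    HasDerivAt trigammaKernel (h t) t := by
  have h1 := one_sub_exp_neg_pos ht
  have h2 : HasDerivAt (fun s : ℝ => 1 - Real.exp (-s)) (Real.exp (-t)) t := by
    simpa using ((hasDerivAt_neg t).exp).const_sub 1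
  convert! (hasDerivAt_id t).div h2 h1.ne' using 1
  have h3 : Real.exp t - 1 ≠ 0 := by linarith [Real.add_one_lt_exp ht.ne']
  rw [h, if_neg ht.ne']
  rw [Real.exp_neg] at h1 ⊢
  have h4 := (Real.exp_pos t).ne'
  simp only [id]
  have h5 : 1 - (Real.exp t)⁻¹ = (Real.exp t - 1) / Real.exp t := by field_simp
  rw [h5]
  field_simp

lemma integrableOn_of_abs_le {f : ℝ → ℝ} (hf : Measurable f) (k : ℕ) {x : ℝ} (hx : 0 < x)
    (hb : ∀ t, 0 < t → |f t| ≤ 1 + t) :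
    IntegrableOn (fun t : ℝ => t ^ k * f t * Real.exp (-x * t)) (Ioi 0) := by
  refine ((integrableOn_pow_mul_exp k hx).add (integrableOn_pow_mul_exp (k + 1) hx)).mono'
    (by fun_prop) ?_
  refine (ae_restrict_iff' measurableSet_Ioi).2 (Eventually.of_forall fun t (ht : 0 < t) => ?_)
  rw [norm_mul, norm_mul, norm_pow, Real.norm_eq_abs, Real.norm_eq_abs, Real.norm_eq_abs,
    abs_of_pos ht, Real.abs_exp]
  calc t ^ k * |f t| * Real.exp (-x * t) ≤ t ^ k * (1 + t) * Real.exp (-x * t) := by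
        gcongr; exact hb t ht
    _ = _ := by simp only [Pi.add_apply]; ring

lemma integrableOn_pow_mul_h_mul_exp (k : ℕ) {x : ℝ} (hx : 0 < x) :
    IntegrableOn (fun t : ℝ => t ^ k * h t * Real.exp (-x * t)) (Ioi 0) :=
  integrableOn_of_abs_le measurable_h k hx fun t ht => by
    rw [abs_of_pos (h_pos ht)]; linarith [h_le_one ht]

lemma integrableOn_trigammaKernel_mul_exp {x : ℝ} (hx : 0 < x) :
    IntegrableOn (fun t : ℝ => trigammaKernel t * Real.exp (-x * t)) (Ioi 0) := by
  have hm : Measurable trigammaKernel := by unfold trigammaKernel; fun_prop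
  have := integrableOn_of_abs_le hm 0 hx fun t ht => by
    rw [abs_of_pos (by linarith [one_le_trigammaKernel ht])]; exact trigammaKernel_le ht
  simpa using this

/-- The trigamma series as a Laplace transform. -/
lemma tsum_inv_sq_eq_integral {x : ℝ} (hx : 0 < x) :
    ∑' n : ℕ, ((x + n) ^ 2)⁻¹ = ∫ t in Ioi (0 : ℝ), trigammaKernel t * Real.exp (-x * t) := by
  have hxn : ∀ n : ℕ, 0 < x + n := fun n => by positivity
  have hi : ∀ n : ℕ, Integrable (fun t : ℝ => t * Real.exp (-(x + n) * t))
      (volume.restrict (Ioi 0)) := fun n => by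
    simpa [IntegrableOn] using integrableOn_pow_mul_exp 1 (hxn n)
  have hn : ∀ n : ℕ, ∫ t in Ioi (0 : ℝ), ‖t * Real.exp (-(x + n) * t)‖ = ((x + n) ^ 2)⁻¹ :=
    fun n => by
      rw [← integral_mul_exp (hxn n)]
      refine setIntegral_congr_fun measurableSet_Ioi fun t (ht : 0 < t) => ?_
      exact Real.norm_of_nonneg (by positivity)
  have hs : Summable fun n : ℕ => ∫ t in Ioi (0 : ℝ), ‖t * Real.exp (-(x + n) * t)‖ := by
    simp_rw [hn]
    exact summable_inv_add_sq hx
  have key := (hasSum_integral_of_summable_integral_norm hi hs).tsum_eq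
  simp_rw [fun n : ℕ => integral_mul_exp (hxn n)] at key
  rw [key]
  refine setIntegral_congr_fun measurableSet_Ioi fun t (ht : 0 < t) => ?_
  have hg : ∀ n : ℕ, t * Real.exp (-(x + n) * t) =
      t * Real.exp (-x * t) * Real.exp (-t) ^ n := fun n => by
    rw [← Real.exp_nat_mul, mul_assoc, ← Real.exp_add]
    ring_nf
  simp only [hg]
  rw [tsum_mul_left, tsum_geometric_of_lt_one (Real.exp_pos _).le
    (by linarith [one_sub_exp_neg_pos ht]), trigammaKernel]
  ring

theorem Phi_eq_integral {x : ℝ} (hx : 0 < x) :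
    Phi x = ∫ t in Ioi (0 : ℝ), h t * Real.exp (-x * t) := by
  have hv : ∀ t : ℝ, HasDerivAt (fun t => Real.exp (-x * t)) (Real.exp (-x * t) * -x) t :=
    fun t => by simpa using ((hasDerivAt_id t).const_mul (-x)).exp
  have hI : IntegrableOn (h * fun t => Real.exp (-x * t)) (Ioi 0) := by
    simpa [Pi.mul_def] using integrableOn_pow_mul_h_mul_exp 0 hx
  have hI' : IntegrableOn (trigammaKernel * fun t => Real.exp (-x * t) * -x) (Ioi 0) := by
    simpa [IntegrableOn, Pi.mul_def, mul_assoc] using (integrableOn_trigammaKernel_mul_exp hx).mul_const (-x)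
  have hk0 : Tendsto trigammaKernel (𝓝[>] 0) (𝓝 1) := by
    have h1 : Tendsto (fun t : ℝ => 1 + t) (𝓝[>] 0) (𝓝 1) := by
      have : ContinuousAt (fun t : ℝ => 1 + t) 0 := by fun_prop
      simpa using this.tendsto.mono_left nhdsWithin_le_nhds
    refine tendsto_of_tendsto_of_tendsto_of_le_of_le' tendsto_const_nhds h1 ?_ ?_
    · filter_upwards [self_mem_nhdsWithin] with t ht using one_le_trigammaKernel ht
    · filter_upwards [self_mem_nhdsWithin] with t ht using trigammaKernel_le ht
  have hzero : Tendsto (trigammaKernel * fun t => Real.exp (-x * t)) (𝓝[>] 0) (𝓝 1) := by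
    have h1 : Tendsto (fun t : ℝ => Real.exp (-x * t)) (𝓝[>] 0) (𝓝 1) := by
      have : ContinuousAt (fun t : ℝ => Real.exp (-x * t)) 0 := by fun_prop
      simpa using this.tendsto.mono_left nhdsWithin_le_nhds
    simpa [Pi.mul_def] using hk0.mul h1
  have hinf : Tendsto (trigammaKernel * fun t => Real.exp (-x * t)) atTop (𝓝 0) := by
    have h0 := tendsto_rpow_mul_exp_neg_mul_atTop_nhds_zero 0 x hx
    have h1 := tendsto_rpow_mul_exp_neg_mul_atTop_nhds_zero 1 x hx
    have h2 := h0.add h1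
    simp only [Real.rpow_zero, Real.rpow_one, add_zero] at h2
    refine tendsto_of_tendsto_of_tendsto_of_le_of_le' tendsto_const_nhds h2 ?_ ?_
    · filter_upwards [eventually_gt_atTop 0] with t ht
      have := one_le_trigammaKernel ht
      simp only [Pi.mul_apply]
      positivity
    · filter_upwards [eventually_gt_atTop 0] with t ht
      rw [← add_mul]
      exact mul_le_mul_of_nonneg_right (trigammaKernel_le ht) (Real.exp_pos _).le
  have key := integral_Ioi_mul_deriv_eq_deriv_mul (fun t ht => hasDerivAt_trigammaKernel ht)
    (fun t _ => hv t) hI' hI hzero hinf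
  simp_rw [← mul_assoc] at key
  rw [integral_mul_const] at key
  rw [Phi, iteratedDeriv_two_log_Gamma hx, tsum_inv_sq_eq_integral hx]
  linarith

lemma hasDerivAt_laplace_pow_mul_h (k : ℕ) {x : ℝ} (hx : 0 < x) :
    HasDerivAt (fun y => ∫ t in Ioi (0 : ℝ), t ^ k * h t * Real.exp (-y * t))
      (-∫ t in Ioi (0 : ℝ), t ^ (k + 1) * h t * Real.exp (-x * t)) x := by
  have hm := measurable_h
  rw [← integral_neg]
  refine (hasDerivAt_integral_of_dominated_loc_of_deriv_le (s := Ioi (x / 2))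
    (μ := volume.restrict (Ioi 0)) (F := fun y t => t ^ k * h t * Real.exp (-y * t))
    (F' := fun y t => -(t ^ (k + 1) * h t * Real.exp (-y * t))) (x₀ := x)
    (bound := fun t => t ^ (k + 1) * h t * Real.exp (-(x / 2) * t)) (Ioi_mem_nhds (by linarith))
    (Eventually.of_forall fun y => by fun_prop) (integrableOn_pow_mul_h_mul_exp k hx)
    (by fun_prop) ?_ (integrableOn_pow_mul_h_mul_exp (k + 1) (half_pos hx)) ?_).2
  · refine (ae_restrict_iff' measurableSet_Ioi).2
      (Eventually.of_forall fun t (ht : 0 < t) y (hy : x / 2 < y) => ?_)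
    have := h_pos ht
    rw [norm_neg, Real.norm_of_nonneg (by positivity)]
    gcongr
  · refine Eventually.of_forall fun t y _ => ?_
    have : HasDerivAt (fun y => Real.exp (-y * t)) (Real.exp (-y * t) * -t) y := by
      simpa using ((hasDerivAt_neg y).mul_const t).exp
    convert! this.const_mul (t ^ k * h t) using 1
    ring

theorem iteratedDeriv_Phi (k : ℕ) {x : ℝ} (hx : 0 < x) :
    iteratedDeriv k Phi x =
      (-1) ^ k * ∫ t in Ioi (0 : ℝ), t ^ k * h t * Real.exp (-x * t) := by
  induction k generalizing x with
  | zero => simp [Phi_eq_integral hx]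
  | succ k ih =>
    rw [iteratedDeriv_succ]
    have : HasDerivAt (iteratedDeriv k Phi)
        ((-1) ^ k * -∫ t in Ioi (0 : ℝ), t ^ (k + 1) * h t * Real.exp (-x * t)) x := by
      refine ((hasDerivAt_laplace_pow_mul_h k hx).const_mul _).congr_of_eventuallyEq ?_
      filter_upwards [Ioi_mem_nhds hx] with y hy using ih hy
    rw [this.deriv]
    ring

theorem calY_integral_repr (m n : ℕ) (x : ℝ) (hx : 0 < x) (ω : ℝ) :
    (-1:ℝ) ^ (m + n + 1) *
      (iteratedDeriv (m + n + 1) Phi x + ω * iteratedDeriv m Phi x * iteratedDeriv n Phi x) =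
    ∫ t in Set.Ioi (0:ℝ),
      (1 - ω / frakY m n t) * t ^ (m + n + 1) * h t * Real.exp (-x * t) := by
  set F : ℕ → ℝ → ℝ := fun k t => t ^ k * h t * Real.exp (-x * t) with hF
  set C : ℝ → ℝ := fun t => ∫ u in (0 : ℝ)..t, F m u * F n (t - u) with hC
  have hI : ∀ k, IntegrableOn (F k) (Ioi 0) := fun k => integrableOn_pow_mul_h_mul_exp k hx
  have hprod : ∫ t in Ioi (0 : ℝ), C t =
      (∫ t in Ioi (0 : ℝ), F m t) * ∫ t in Ioi (0 : ℝ), F n t := by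
    simpa using integral_posConvolution (hI m) (hI n) (ContinuousLinearMap.mul ℝ ℝ)
  have hCI : IntegrableOn C (Ioi 0) := by
    rw [← integrable_indicator_iff measurableSet_Ioi]
    simpa [posConvolution] using
      integrable_posConvolution (hI m) (hI n) (ContinuousLinearMap.mul ℝ ℝ)
  have hCeq : ∀ t, C t =
      (∫ u in (0 : ℝ)..t, u ^ m * (t - u) ^ n * h u * h (t - u)) * Real.exp (-x * t) := fun t => by
    rw [← intervalIntegral.integral_mul_const]
    refine intervalIntegral.integral_congr fun u _ => ?_
    have : Real.exp (-x * t) = Real.exp (-x * u) * Real.exp (-x * (t - u)) := by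
      rw [← Real.exp_add]; ring_nf
    simp only [hF, this]
    ring
  have hint : ∫ t in Ioi (0 : ℝ), (1 - ω / frakY m n t) * t ^ (m + n + 1) * h t *
      Real.exp (-x * t) = ∫ t in Ioi (0 : ℝ), (F (m + n + 1) t - ω * C t) := by
    refine setIntegral_congr_fun measurableSet_Ioi fun t (ht : 0 < t) => ?_
    have h1 := (h_pos ht).ne'
    have h2 := ht.ne'
    simp only [hCeq, hF, frakY]
    field_simp
  rw [hint, integral_sub (hI _) (hCI.const_mul ω), integral_const_mul, hprod,
    iteratedDeriv_Phi _ hx, iteratedDeriv_Phi _ hx, iteratedDeriv_Phi _ hx]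
  have hs : ((-1 : ℝ) ^ m) ^ 2 = 1 := by rw [← pow_mul, mul_comm, pow_mul]; simp
  have hs' : ((-1 : ℝ) ^ n) ^ 2 = 1 := by rw [← pow_mul, mul_comm, pow_mul]; simp
  generalize (∫ t in Ioi (0 : ℝ), F m t) = A
  generalize (∫ t in Ioi (0 : ℝ), F n t) = B
  generalize (∫ t in Ioi (0 : ℝ), F (m + n + 1) t) = D
  linear_combination (D - ω * A * B) * (((-1 : ℝ) ^ m) ^ 2 * hs' + hs)
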